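/- arXiv:1604.07718 — 6 statements merged into one kernel-verified Lean document; each statement's English description precedes it below -/
import Mathlib

section
/- The function Zqr is differentiable at every x ∈ ℝ, with derivative Zqr′(x) = (q/(r+q))·φ·J(x). In particular this holds also at x = 0, where the contributions of the possible jump of W at 0 to the one-sided derivatives of Zq and J cancel. -/
open MeasureTheory Real Set Filter Topology

/-- `Wbar x = ∫_0^x W(z) dz`. -/
noncomputable def Wbar (W : ℝ → ℝ) (x : ℝ) : ℝ := ∫ z in (0:ℝ)..x, W z

/-- `Zq x = 1 + q · Wbar x`. -/
noncomputable def Zq (q : ℝ) (W : ℝ → ℝ) (x : ℝ) : ℝ := 1 + q * Wbar W x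

/-- `Zbar x = ∫_0^x Zq(z) dz`. -/
noncomputable def Zbar (q : ℝ) (W : ℝ → ℝ) (x : ℝ) : ℝ := ∫ z in (0:ℝ)..x, Zq q W z

/-- `J x = e^{φx} (1 − r ∫_0^x e^{−φz} W(z) dz)`. -/
noncomputable def Jfun (r φ : ℝ) (W : ℝ → ℝ) (x : ℝ) : ℝ :=
  Real.exp (φ * x) * (1 - r * ∫ z in (0:ℝ)..x, Real.exp (-φ * z) * W z)

/-- `Zqr x = (r/(r+q)) Zq x + (q/(r+q)) J x`. -/
noncomputable def Zqr (q r φ : ℝ) (W : ℝ → ℝ) (x : ℝ) : ℝ :=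
  (r / (r + q)) * Zq q W x + (q / (r + q)) * Jfun r φ W x

/-- If the integrand has left limit `c` at `x`, its primitive has left derivative `c` there. -/
theorem hasDerivWithinAt_integral_Iic_of_tendsto {f : ℝ → ℝ} {a x c : ℝ}
    (hf : LocallyIntegrable f) (hc : Tendsto f (𝓝[<] x) (𝓝 c)) :
    HasDerivWithinAt (fun u => ∫ z in a..u, f z) c (Iic x) x := by
  have hle : 𝓝[≤] x ⊓ ae (volume : Measure ℝ) ≤ 𝓝[<] x := by
    have hne : ({x}ᶜ : Set ℝ) ∈ ae (volume : Measure ℝ) :=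
      compl_mem_ae_iff.2 (measure_singleton x)
    calc 𝓝[≤] x ⊓ ae (volume : Measure ℝ)
        ≤ 𝓝[≤] x ⊓ 𝓟 {x}ᶜ := inf_le_inf_left _ (le_principal_iff.2 hne)
      _ = 𝓝[Iic x ∩ {x}ᶜ] x := by rw [nhdsWithin, nhdsWithin, inf_assoc, inf_principal]
      _ ≤ 𝓝[<] x := nhdsWithin_mono _ fun _ hy => lt_of_le_of_ne hy.1 hy.2
  exact intervalIntegral.integral_hasDerivWithinAt_of_tendsto_ae_right
    (hf.integrableOn_isCompact isCompact_uIcc).intervalIntegrable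
    hf.aestronglyMeasurable.stronglyMeasurableAtFilter
    (hc.mono_left hle)

/-- If the integrand has right limit `c` at `x`, its primitive has right derivative `c` there. -/
theorem hasDerivWithinAt_integral_Ici_of_tendsto {f : ℝ → ℝ} {a x c : ℝ}
    (hf : LocallyIntegrable f) (hc : Tendsto f (𝓝[>] x) (𝓝 c)) :
    HasDerivWithinAt (fun u => ∫ z in a..u, f z) c (Ici x) x :=
  intervalIntegral.integral_hasDerivWithinAt_of_tendsto_ae_right
    (hf.integrableOn_isCompact isCompact_uIcc).intervalIntegrable
    hf.aestronglyMeasurable.stronglyMeasurableAtFilter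
    (hc.mono_left inf_le_left)

/-- In the derivative of `Zqr` along a set, the contributions `c` of `W` cancel. -/
theorem Zqr_hasDerivWithinAt {q r φ c x : ℝ} {W : ℝ → ℝ} {s : Set ℝ}
    (hF : HasDerivWithinAt (fun u => ∫ z in (0:ℝ)..u, W z) c s x)
    (hG : HasDerivWithinAt (fun u => ∫ z in (0:ℝ)..u, Real.exp (-φ * z) * W z)
      (Real.exp (-φ * x) * c) s x) :
    HasDerivWithinAt (Zqr q r φ W) (q / (r + q) * φ * Jfun r φ W x) s x := by
  have hE : HasDerivWithinAt (fun u => Real.exp (φ * u)) (Real.exp (φ * x) * φ) s x := by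
    simpa using (((hasDerivAt_id x).const_mul φ).exp).hasDerivWithinAt
  have h := (((hF.const_mul q).const_add 1).const_mul (r / (r + q))).add
    ((hE.mul ((hG.const_mul r).const_sub 1)).const_mul (q / (r + q)))
  have hexp : Real.exp (φ * x) * Real.exp (-φ * x) = 1 := by
    rw [← Real.exp_add]; simp
  refine h.congr_deriv ?_
  unfold Jfun
  linear_combination (-(q / (r + q)) * r * c) * hexp

/-- Zqr is differentiable everywhere with Zqr′(x) = (q/(r+q))·φ·J(x),
including at x = 0. -/
theorem Zqr_hasDerivAt
    (q r φ : ℝ) (W : ℝ → ℝ)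
    (hq : 0 < q) (hr : 0 < r) (hφ : 0 < φ)
    (hWneg : ∀ x < (0:ℝ), W x = 0)
    (hWnn : ∀ x : ℝ, 0 ≤ W x)
    (hWcont : ContinuousOn W (Set.Ioi 0))
    (hWmono : StrictMonoOn W (Set.Ioi 0))
    (W0 : ℝ)
    (hW0 : Filter.Tendsto W (nhdsWithin 0 (Set.Ioi 0)) (nhds W0))
    (hWint : MeasureTheory.IntegrableOn (fun z => Real.exp (-φ * z) * W z) (Set.Ioi 0))
    (hWlap : r * ∫ z in Set.Ioi (0:ℝ), Real.exp (-φ * z) * W z = 1)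
    : ∀ x : ℝ, HasDerivAt (Zqr q r φ W) (q / (r + q) * φ * Jfun r φ W x) x := by
  have hGint : Integrable fun z => Real.exp (-φ * z) * W z := by
    rw [← integrableOn_univ, ← Iio_union_Ici (a := (0:ℝ)), integrableOn_union,
      integrableOn_Ici_iff_integrableOn_Ioi]
    refine ⟨(integrableOn_zero (μ := volume) (s := Iio (0:ℝ))).congr_fun (fun z hz => ?_)
      measurableSet_Iio, hWint⟩
    simp [hWneg z hz]
  have hGloc := hGint.locallyIntegrable
  have hWloc : LocallyIntegrable W := by
    have h := hGloc.continuous_mul (g := fun z => Real.exp (φ * z)) (by fun_prop)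
    refine h.congr (ae_of_all _ fun z => ?_)
    simp [← mul_assoc, ← Real.exp_add]
  have hlim (x : ℝ) : (∃ c, Tendsto W (𝓝[<] x) (𝓝 c)) ∧ ∃ c, Tendsto W (𝓝[>] x) (𝓝 c) := by
    have hleft (h : x ≤ 0) : Tendsto W (𝓝[<] x) (𝓝 0) :=
      tendsto_const_nhds.congr' <| by
        filter_upwards [self_mem_nhdsWithin] with z hz using (hWneg z (lt_of_lt_of_le hz h)).symm
    rcases lt_trichotomy x 0 with h | rfl | h
    · refine ⟨⟨0, hleft h.le⟩, 0, tendsto_const_nhds.congr' ?_⟩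
      filter_upwards [mem_nhdsWithin_of_mem_nhds (Iio_mem_nhds h)] with z hz
        using (hWneg z hz).symm
    · exact ⟨⟨0, hleft le_rfl⟩, W0, hW0⟩
    · have hc : Tendsto W (𝓝 x) (𝓝 (W x)) := hWcont.continuousAt (Ioi_mem_nhds h)
      exact ⟨⟨_, hc.mono_left inf_le_left⟩, _, hc.mono_left inf_le_left⟩
  intro x
  obtain ⟨⟨c, hc⟩, d, hd⟩ := hlim x
  have hexp : Tendsto (fun z => Real.exp (-φ * z)) (𝓝 x) (𝓝 (Real.exp (-φ * x))) :=
    Continuous.tendsto (by fun_prop) x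
  have hleft := Zqr_hasDerivWithinAt (q := q) (r := r)
    (hasDerivWithinAt_integral_Iic_of_tendsto hWloc hc)
    (hasDerivWithinAt_integral_Iic_of_tendsto hGloc ((hexp.mono_left inf_le_left).mul hc))
  have hright := Zqr_hasDerivWithinAt (q := q) (r := r)
    (hasDerivWithinAt_integral_Ici_of_tendsto hWloc hd)
    (hasDerivWithinAt_integral_Ici_of_tendsto hGloc ((hexp.mono_left inf_le_left).mul hd))
  simpa using hleft.union hright
end

section
/- The function Zqr is strictly increasing on ℝ and Zqr(x) > 0 for every x ∈ ℝ; moreover Zqr(x) = r/(r+q) + (q/(r+q))·e^{φx} for every x ≤ 0 (in particular Zqr(0) = 1), and Zqr(x) → ∞ as x → ∞. -/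
open MeasureTheory Real Set Filter Topology

theorem intervalIntegral_eq_zero_of_forall_neg {g : ℝ → ℝ} (hg : ∀ x < (0:ℝ), g x = 0)
    {x : ℝ} (hx : x ≤ 0) : ∫ z in (0:ℝ)..x, g z = 0 := by
  rw [intervalIntegral.integral_symm, intervalIntegral.integral_of_le hx,
    integral_Ioc_eq_integral_Ioo, setIntegral_eq_zero_of_forall_eq_zero fun z hz => hg z hz.2,
    neg_zero]

theorem integrableOn_Ioi_comp_add_right {g : ℝ → ℝ} {x : ℝ} (hg : IntegrableOn g (Ioi x)) :
    IntegrableOn (fun u => g (u + x)) (Ioi 0) := by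
  have h := ((measurePreserving_add_right volume x).integrableOn_comp_preimage
    (MeasurableEquiv.addRight x).measurableEmbedding).2 hg
  simpa [Function.comp_def] using h

theorem integral_Ioi_comp_add_right (g : ℝ → ℝ) (x : ℝ) :
    ∫ u in Ioi (0:ℝ), g (u + x) = ∫ z in Ioi x, g z := by
  have h := (measurePreserving_add_right volume x).setIntegral_preimage_emb
    (MeasurableEquiv.addRight x).measurableEmbedding g (Ioi x)
  simpa using h

theorem exp_mul_exp_neg_mul_add (φ x u : ℝ) :
    Real.exp (φ * x) * Real.exp (-φ * (u + x)) = Real.exp (-φ * u) := by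
  rw [← Real.exp_add]
  ring_nf

/-- `W` is locally integrable, as its exponentially tilted version is integrable. -/
theorem intervalIntegrable_of_exp_mul {φ : ℝ} {W : ℝ → ℝ}
    (hWint : IntegrableOn (fun z => Real.exp (-φ * z) * W z) (Ioi 0))
    {x y : ℝ} (hx : 0 ≤ x) (hxy : x ≤ y) : IntervalIntegrable W volume x y := by
  have h : IntervalIntegrable (fun z => Real.exp (-φ * z) * W z) volume x y :=
    (intervalIntegrable_iff_integrableOn_Ioc_of_le hxy).2
      (hWint.mono_set fun z hz => lt_of_le_of_lt hx hz.1)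
  have hc : Continuous fun z : ℝ => Real.exp (φ * z) := by fun_prop
  refine (h.continuousOn_mul hc.continuousOn).congr fun z _ => ?_
  rw [← mul_assoc, ← Real.exp_add]
  simp

/-- `J x` is the Laplace transform of `W` shifted by `x`, scaled by `r`. -/
theorem Jfun_eq_integral {r φ : ℝ} {W : ℝ → ℝ}
    (hWint : IntegrableOn (fun z => Real.exp (-φ * z) * W z) (Ioi 0))
    (hWlap : r * ∫ z in Ioi (0:ℝ), Real.exp (-φ * z) * W z = 1) {x : ℝ} (hx : 0 ≤ x) :
    Jfun r φ W x = r * ∫ u in Ioi (0:ℝ), Real.exp (-φ * u) * W (u + x) := by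
  have hadd := intervalIntegral.integral_interval_add_Ioi hWint
    (hWint.mono_set (Ioi_subset_Ioi hx))
  rw [← integral_Ioi_comp_add_right _ x] at hadd
  have hshift : ∫ u in Ioi (0:ℝ), Real.exp (-φ * u) * W (u + x) =
      Real.exp (φ * x) * ∫ u in Ioi (0:ℝ), Real.exp (-φ * (u + x)) * W (u + x) := by
    rw [← integral_const_mul]
    simp only [← mul_assoc, exp_mul_exp_neg_mul_add]
  rw [hshift, Jfun, ← hWlap, ← hadd]
  ring

theorem integrableOn_exp_mul_comp_add_right {φ : ℝ} {W : ℝ → ℝ}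
    (hWint : IntegrableOn (fun z => Real.exp (-φ * z) * W z) (Ioi 0)) {x : ℝ} (hx : 0 ≤ x) :
    IntegrableOn (fun u => Real.exp (-φ * u) * W (u + x)) (Ioi 0) := by
  have h := (integrableOn_Ioi_comp_add_right
    (hWint.mono_set (Ioi_subset_Ioi hx))).const_mul (Real.exp (φ * x))
  simpa only [IntegrableOn, ← mul_assoc, exp_mul_exp_neg_mul_add] using h

theorem Jfun_monotoneOn {r φ : ℝ} {W : ℝ → ℝ} (hr : 0 ≤ r) (hWmono : MonotoneOn W (Ioi 0))
    (hWint : IntegrableOn (fun z => Real.exp (-φ * z) * W z) (Ioi 0))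
    (hWlap : r * ∫ z in Ioi (0:ℝ), Real.exp (-φ * z) * W z = 1) :
    MonotoneOn (Jfun r φ W) (Ici 0) := by
  intro x hx y hy hxy
  rw [Jfun_eq_integral hWint hWlap hx, Jfun_eq_integral hWint hWlap hy]
  refine mul_le_mul_of_nonneg_left (setIntegral_mono_on
    (integrableOn_exp_mul_comp_add_right hWint hx)
    (integrableOn_exp_mul_comp_add_right hWint hy) measurableSet_Ioi fun u hu => ?_) hr
  refine mul_le_mul_of_nonneg_left ?_ (Real.exp_pos _).le
  exact hWmono (mem_Ioi.2 (add_pos_of_pos_of_nonneg hu hx))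
    (mem_Ioi.2 (add_pos_of_pos_of_nonneg hu hy)) (by linarith)

theorem Wbar_strictMonoOn {W : ℝ → ℝ} (hWpos : ∀ x, 0 < x → 0 < W x)
    (hW : ∀ x y, 0 ≤ x → x ≤ y → IntervalIntegrable W volume x y) :
    StrictMonoOn (Wbar W) (Ici 0) := by
  intro x hx y hy hxy
  have hpos := intervalIntegral.intervalIntegral_pos_of_pos_on (hW x y hx hxy.le)
    (fun z hz => hWpos z (lt_of_le_of_lt hx hz.1)) hxy
  have hadd := intervalIntegral.integral_add_adjacent_intervals (hW 0 x le_rfl hx)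
    (hW x y hx hxy.le)
  simp only [Wbar]
  linarith

theorem tendsto_Wbar_atTop {W : ℝ → ℝ} (hWnn : ∀ x, 0 ≤ W x) (hWpos : 0 < W 1)
    (hWmono : MonotoneOn W (Ioi 0))
    (hW : ∀ x y, 0 ≤ x → x ≤ y → IntervalIntegrable W volume x y) :
    Tendsto (Wbar W) atTop atTop := by
  have hlin : Tendsto (fun x : ℝ => (x - 1) * W 1) atTop atTop :=
    (tendsto_atTop_add_const_right _ _ tendsto_id).atTop_mul_const hWpos
  refine tendsto_atTop_mono' _ ?_ hlin
  filter_upwards [eventually_ge_atTop (1:ℝ)] with x hx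
  have hnn : 0 ≤ ∫ z in (0:ℝ)..1, W z :=
    intervalIntegral.integral_nonneg zero_le_one fun z _ => hWnn z
  have hadd := intervalIntegral.integral_add_adjacent_intervals
    (hW 0 1 le_rfl zero_le_one) (hW 1 x zero_le_one hx)
  have hle : ∫ _ in (1:ℝ)..x, W 1 ≤ ∫ z in (1:ℝ)..x, W z :=
    intervalIntegral.integral_mono_on hx (by simp) (hW 1 x zero_le_one hx) fun z hz =>
      hWmono (mem_Ioi.2 one_pos) (mem_Ioi.2 (one_pos.trans_le hz.1)) hz.1
  rw [intervalIntegral.integral_const, smul_eq_mul] at hle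
  simp only [Wbar]
  linarith

theorem Zqr_of_nonpos {q r φ : ℝ} {W : ℝ → ℝ} (hWneg : ∀ x < (0:ℝ), W x = 0) {x : ℝ}
    (hx : x ≤ 0) : Zqr q r φ W x = r / (r + q) + q / (r + q) * Real.exp (φ * x) := by
  have h : ∫ z in (0:ℝ)..x, Real.exp (-φ * z) * W z = 0 :=
    intervalIntegral_eq_zero_of_forall_neg (fun z hz => by simp [hWneg z hz]) hx
  rw [Zqr, Zq, Jfun, Wbar, intervalIntegral_eq_zero_of_forall_neg hWneg hx, h]
  ring

/-- Zqr is strictly increasing and positive; for x ≤ 0,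
Zqr(x) = r/(r+q) + (q/(r+q))·e^{φx} (in particular Zqr(0) = 1); and Zqr(x) → ∞ as x → ∞. -/
theorem Zqr_strictMono_pos
    (q r φ : ℝ) (W : ℝ → ℝ)
    (hq : 0 < q) (hr : 0 < r) (hφ : 0 < φ)
    (hWneg : ∀ x < (0:ℝ), W x = 0)
    (hWnn : ∀ x : ℝ, 0 ≤ W x)
    (hWcont : ContinuousOn W (Set.Ioi 0))
    (hWmono : StrictMonoOn W (Set.Ioi 0))
    (W0 : ℝ)
    (hW0 : Filter.Tendsto W (nhdsWithin 0 (Set.Ioi 0)) (nhds W0))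
    (hWint : MeasureTheory.IntegrableOn (fun z => Real.exp (-φ * z) * W z) (Set.Ioi 0))
    (hWlap : r * ∫ z in Set.Ioi (0:ℝ), Real.exp (-φ * z) * W z = 1)
    : StrictMono (Zqr q r φ W) ∧ (∀ x : ℝ, 0 < Zqr q r φ W x) ∧
      (∀ x : ℝ, x ≤ 0 → Zqr q r φ W x = r / (r + q) + q / (r + q) * Real.exp (φ * x)) ∧
      Zqr q r φ W 0 = 1 ∧
      Filter.Tendsto (Zqr q r φ W) Filter.atTop Filter.atTop := by
  have hqr : 0 < q / (r + q) := by positivity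
  have hrq : 0 < r / (r + q) := by positivity
  have hWpos : ∀ x, 0 < x → 0 < W x := fun x hx =>
    (hWnn (x / 2)).trans_lt (hWmono (half_pos hx) hx (half_lt_self hx))
  have hW : ∀ x y, 0 ≤ x → x ≤ y → IntervalIntegrable W volume x y :=
    fun x y hx hxy => intervalIntegrable_of_exp_mul hWint hx hxy
  have hJ := Jfun_monotoneOn hr.le hWmono.monotoneOn hWint hWlap
  have hneg : ∀ x : ℝ, x ≤ 0 →
      Zqr q r φ W x = r / (r + q) + q / (r + q) * Real.exp (φ * x) :=
    fun x hx => Zqr_of_nonpos hWneg hx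
  have hzero : Zqr q r φ W 0 = 1 := by
    rw [hneg 0 le_rfl, mul_zero, Real.exp_zero, mul_one, ← add_div, div_self (by positivity)]
  have hmono : StrictMono (Zqr q r φ W) := by
    refine StrictMonoOn.Iic_union_Ici (a := 0) (fun x hx y hy hxy => ?_) fun x hx y hy hxy => ?_
    · rw [hneg x hx, hneg y hy]
      gcongr
    · have h₁ := Wbar_strictMonoOn hWpos hW hx hy hxy
      have h₂ := hJ hx hy hxy.le
      simp only [Zqr, Zq]
      refine add_lt_add_of_lt_of_le ?_ ?_ <;> gcongr
  refine ⟨hmono, fun x => ?_, hneg, hzero, ?_⟩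
  · rcases le_total x 0 with hx | hx
    · rw [hneg x hx]
      positivity
    · exact zero_lt_one.trans_le (hzero ▸ hmono.monotone hx)
  · have hlim := (tendsto_atTop_add_const_left _ 1
      ((tendsto_Wbar_atTop hWnn (hWpos 1 one_pos) hWmono.monotoneOn hW).const_mul_atTop
        hq)).const_mul_atTop hrq
    refine tendsto_atTop_mono' _ ?_ hlim
    filter_upwards [eventually_ge_atTop (0:ℝ)] with x hx
    have hJ₀ : 0 ≤ Jfun r φ W x := by
      refine le_trans ?_ (hJ self_mem_Ici hx hx)
      simp [Jfun]
    exact le_add_of_nonneg_right (mul_nonneg hqr.le hJ₀)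
end

section
/- For every β > 1 there exists a unique b > 0 such that Zqr(b) = β. -/
open MeasureTheory Real Set Filter Topology

lemma integrable_exp_neg_mul {φ : ℝ} {W : ℝ → ℝ} (hWneg : ∀ x < (0:ℝ), W x = 0)
    (hWint : IntegrableOn (fun z => Real.exp (-φ * z) * W z) (Set.Ioi 0)) :
    Integrable (fun z => Real.exp (-φ * z) * W z) := by
  have hneg : IntegrableOn (fun z => Real.exp (-φ * z) * W z) (Set.Iio 0) :=
    integrableOn_zero.congr_fun (fun z hz => by simp [hWneg z hz]) measurableSet_Iio
  have hunion := hneg.union ((integrableOn_Ici_iff_integrableOn_Ioi enorm_ne_top).2 hWint)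
  rwa [Set.Iio_union_Ici, integrableOn_univ] at hunion

lemma intervalIntegrable_of_integrable_exp_mul {φ : ℝ} {W : ℝ → ℝ}
    (h : Integrable (fun z => Real.exp (-φ * z) * W z)) (a b : ℝ) :
    IntervalIntegrable W volume a b := by
  have hmul := (h.intervalIntegrable (a := a) (b := b)).continuousOn_mul
    (g := fun z => Real.exp (φ * z)) (by fun_prop)
  refine hmul.congr fun z _ => ?_
  simp [← mul_assoc, ← Real.exp_add]

lemma StrictMonoOn.pos_of_nonneg_Ioi {W : ℝ → ℝ} (hWmono : StrictMonoOn W (Set.Ioi 0))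
    (hWnn : ∀ x : ℝ, 0 ≤ W x) {x : ℝ} (hx : 0 < x) : 0 < W x :=
  (hWnn (x / 2)).trans_lt (hWmono (half_pos hx) hx (half_lt_self hx))

lemma Jfun_pos {r φ : ℝ} {W : ℝ → ℝ} (hr : 0 < r) (hWnn : ∀ x : ℝ, 0 ≤ W x)
    (hWpos : ∀ x : ℝ, 0 < x → 0 < W x)
    (hWint : Integrable (fun z => Real.exp (-φ * z) * W z))
    (hWlap : r * ∫ z in Set.Ioi (0:ℝ), Real.exp (-φ * z) * W z = 1) {x : ℝ} (hx : 0 ≤ x) :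
    0 < Jfun r φ W x := by
  have hii (a b : ℝ) : IntervalIntegrable (fun z => Real.exp (-φ * z) * W z) volume a b :=
    hWint.intervalIntegrable
  have hpos : 0 < ∫ z in x..(x + 1), Real.exp (-φ * z) * W z :=
    intervalIntegral.intervalIntegral_pos_of_pos_on (hii _ _)
      (fun z hz => mul_pos (Real.exp_pos _) (hWpos z (hx.trans_lt hz.1))) (by linarith)
  have hadd := intervalIntegral.integral_add_adjacent_intervals (hii 0 x) (hii x (x + 1))
  have hle : ∫ z in (0:ℝ)..(x + 1), Real.exp (-φ * z) * W z ≤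
      ∫ z in Set.Ioi (0:ℝ), Real.exp (-φ * z) * W z := by
    rw [intervalIntegral.integral_of_le (by linarith)]
    exact setIntegral_mono_set hWint.integrableOn
      (Filter.Eventually.of_forall fun z => mul_nonneg (Real.exp_pos _).le (hWnn z))
      Set.Ioc_subset_Ioi_self.eventuallyLE
  refine mul_pos (Real.exp_pos _) (sub_pos.2 ?_)
  rw [← hWlap]
  exact mul_lt_mul_of_pos_left (by linarith) hr

lemma hasDerivAt_Zqr {q r φ : ℝ} {W : ℝ → ℝ} (hWcont : ContinuousOn W (Set.Ioi 0))
    (hWint : Integrable (fun z => Real.exp (-φ * z) * W z)) {x : ℝ} (hx : 0 < x) :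
    HasDerivAt (Zqr q r φ W) (q / (r + q) * (φ * Jfun r φ W x)) x := by
  have hexp : ContinuousOn (fun z => Real.exp (-φ * z) * W z) (Set.Ioi 0) :=
    ContinuousOn.mul (by fun_prop) hWcont
  have hmem : Set.Ioi (0:ℝ) ∈ 𝓝 x := Ioi_mem_nhds hx
  have hW : HasDerivAt (Wbar W) (W x) x :=
    intervalIntegral.integral_hasDerivAt_right (intervalIntegrable_of_integrable_exp_mul hWint 0 x)
      (hWcont.stronglyMeasurableAtFilter isOpen_Ioi x hx) (hWcont.continuousAt hmem)
  have hI : HasDerivAt (fun y => ∫ z in (0:ℝ)..y, Real.exp (-φ * z) * W z)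
      (Real.exp (-φ * x) * W x) x :=
    intervalIntegral.integral_hasDerivAt_right hWint.intervalIntegrable
      (hexp.stronglyMeasurableAtFilter isOpen_Ioi x hx) (hexp.continuousAt hmem)
  have hE : HasDerivAt (fun y => Real.exp (φ * y)) (Real.exp (φ * x) * (φ * 1)) x :=
    ((hasDerivAt_id x).const_mul φ).exp
  have hJ := hE.mul ((hI.const_mul r).const_sub 1)
  refine ((((hW.const_mul q).const_add 1).const_mul (r / (r + q))).add
    (hJ.const_mul (q / (r + q)))).congr_deriv ?_
  have hinv : Real.exp (φ * x) * Real.exp (-φ * x) = 1 := by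
    rw [← Real.exp_add]; simp
  simp only [Jfun]
  linear_combination (-(q / (r + q)) * r * W x) * hinv

lemma continuous_Zqr {q r φ : ℝ} {W : ℝ → ℝ}
    (hWint : Integrable (fun z => Real.exp (-φ * z) * W z)) : Continuous (Zqr q r φ W) := by
  have hW : Continuous (Wbar W) := intervalIntegral.continuous_primitive
    (intervalIntegrable_of_integrable_exp_mul hWint) 0
  have hI : Continuous fun y => ∫ z in (0:ℝ)..y, Real.exp (-φ * z) * W z :=
    intervalIntegral.continuous_primitive (fun _ _ => hWint.intervalIntegrable) 0
  unfold Zqr Zq Jfun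
  fun_prop

lemma mul_sub_one_le_Wbar {W : ℝ → ℝ} (hWnn : ∀ x : ℝ, 0 ≤ W x)
    (hWmono : MonotoneOn W (Set.Ioi 0)) (hWint : ∀ a b : ℝ, IntervalIntegrable W volume a b)
    {x : ℝ} (hx : 1 ≤ x) : W 1 * (x - 1) ≤ Wbar W x := by
  have h01 : 0 ≤ ∫ z in (0:ℝ)..1, W z :=
    intervalIntegral.integral_nonneg zero_le_one fun z _ => hWnn z
  have h1x : ∫ _ in (1:ℝ)..x, W 1 ≤ ∫ z in (1:ℝ)..x, W z :=
    intervalIntegral.integral_mono_on hx intervalIntegrable_const (hWint 1 x) fun z hz =>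
      hWmono (Set.mem_Ioi.2 one_pos) (Set.mem_Ioi.2 (one_pos.trans_le hz.1)) hz.1
  have hadd := intervalIntegral.integral_add_adjacent_intervals (hWint 0 1) (hWint 1 x)
  rw [intervalIntegral.integral_const, smul_eq_mul] at h1x
  unfold Wbar
  linarith

lemma tendsto_Zqr_atTop {q r φ : ℝ} {W : ℝ → ℝ} (hq : 0 < q) (hr : 0 < r)
    (hWnn : ∀ x : ℝ, 0 ≤ W x) (hWmono : StrictMonoOn W (Set.Ioi 0))
    (hWint : ∀ a b : ℝ, IntervalIntegrable W volume a b)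
    (hJ : ∀ x : ℝ, 0 ≤ x → 0 ≤ Jfun r φ W x) : Tendsto (Zqr q r φ W) atTop atTop := by
  have hlin : Tendsto (fun x : ℝ => r / (r + q) * (1 + q * (W 1 * (x - 1)))) atTop atTop :=
    (tendsto_atTop_add_const_left _ 1 (((tendsto_atTop_add_const_right _ (-1)
      tendsto_id).const_mul_atTop (hWmono.pos_of_nonneg_Ioi hWnn one_pos)).const_mul_atTop
        hq)).const_mul_atTop (by positivity)
  refine tendsto_atTop_mono' _ ?_ hlin
  filter_upwards [eventually_ge_atTop 1] with x hx
  have hZ : 1 + q * (W 1 * (x - 1)) ≤ Zq q W x := by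
    have := mul_sub_one_le_Wbar hWnn hWmono.monotoneOn hWint hx
    unfold Zq
    gcongr
  have hJx : 0 ≤ q / (r + q) * Jfun r φ W x :=
    mul_nonneg (by positivity) (hJ x (zero_le_one.trans hx))
  have hmul := mul_le_mul_of_nonneg_left hZ (show 0 ≤ r / (r + q) by positivity)
  unfold Zqr
  linarith

/-- for every β > 1 there is a unique b > 0 with Zqr(b) = β. -/
theorem exists_unique_barrier_bailout
    (q r φ : ℝ) (W : ℝ → ℝ)
    (hq : 0 < q) (hr : 0 < r) (hφ : 0 < φ)
    (hWneg : ∀ x < (0:ℝ), W x = 0)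
    (hWnn : ∀ x : ℝ, 0 ≤ W x)
    (hWcont : ContinuousOn W (Set.Ioi 0))
    (hWmono : StrictMonoOn W (Set.Ioi 0))
    (W0 : ℝ)
    (hW0 : Filter.Tendsto W (nhdsWithin 0 (Set.Ioi 0)) (nhds W0))
    (hWint : MeasureTheory.IntegrableOn (fun z => Real.exp (-φ * z) * W z) (Set.Ioi 0))
    (hWlap : r * ∫ z in Set.Ioi (0:ℝ), Real.exp (-φ * z) * W z = 1)
    : ∀ β : ℝ, 1 < β → ∃! b : ℝ, 0 < b ∧ Zqr q r φ W b = β := by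
  have hint := integrable_exp_neg_mul hWneg hWint
  have hJ (x : ℝ) (hx : 0 ≤ x) : 0 < Jfun r φ W x :=
    Jfun_pos hr hWnn (fun _ => hWmono.pos_of_nonneg_Ioi hWnn) hint hWlap hx
  have hcont : Continuous (Zqr q r φ W) := continuous_Zqr hint
  have hmono : StrictMonoOn (Zqr q r φ W) (Set.Ici 0) := by
    refine strictMonoOn_of_deriv_pos (convex_Ici 0) hcont.continuousOn fun x hx => ?_
    rw [interior_Ici] at hx
    have := hJ x (le_of_lt hx)
    rw [(hasDerivAt_Zqr hWcont hint hx).deriv]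
    positivity
  have htop : Tendsto (Zqr q r φ W) atTop atTop := tendsto_Zqr_atTop hq hr hWnn hWmono
    (intervalIntegrable_of_integrable_exp_mul hint) fun x hx => (hJ x hx).le
  have hzero : Zqr q r φ W 0 = 1 := by
    simp [Zqr, Zq, Wbar, Jfun]
    field_simp
  intro β hβ
  obtain ⟨c, hcβ, hc⟩ := ((htop.eventually_ge_atTop β).and (eventually_ge_atTop 0)).exists
  obtain ⟨b, hb, hbβ⟩ := intermediate_value_Icc hc hcont.continuousOn
    ⟨hzero.le.trans hβ.le, hcβ⟩
  have hb0 : 0 < b := by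
    refine hb.1.lt_of_ne fun h => ?_
    rw [← h, hzero] at hbβ
    exact hβ.ne hbβ
  exact ⟨b, ⟨hb0, hbβ⟩, fun y hy =>
    hmono.injOn (Set.mem_Ici.2 hy.1.le) (Set.mem_Ici.2 hb0.le) (hy.2.trans hbβ.symm)⟩
end

section
/- Fix b > 0 and m, ρ ∈ ℝ, define H(y) := (r/(r+q))·(Zbar(y) + m/q), C := (H(b) + ρ)/Zqr(b), v_b(x) := C·Zqr(b−x) − H(b−x). Assume W(0+) = 0 and that W is continuously differentiable on (0,∞) with finite right limit W′(0+) > 0 (the unbounded-variation case with σ > 0 or finite jump activity). Then v_b is twice continuously differentiable on ℝ and three times differentiable on ℝ∖{b}, and the one-sided limits of v_b‴ at b satisfy lim_{x↓b} v_b‴(x) − lim_{x↑b} v_b‴(x) = −(rq/(r+q))·W′(0+)·(1 + C·φ); consequently these limits coincide (i.e., v_b is C³ at b) if and only if C = −1/φ. -/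
open MeasureTheory Real Set Filter Topology

theorem hasDerivAt_integral_of_ae_eq {f g : ℝ → ℝ} (hg : Continuous g) (hfg : f =ᵐ[volume] g)
    (a x : ℝ) : HasDerivAt (fun y => ∫ z in a..y, f z) (g x) x := by
  have h : (fun y => ∫ z in a..y, f z) = fun y => ∫ z in a..y, g z := by
    funext y
    exact intervalIntegral.integral_congr_ae (hfg.mono fun z hz _ => hz)
  rw [h]
  exact intervalIntegral.integral_hasDerivAt_right (hg.intervalIntegrable _ _)
    hg.stronglyMeasurable.stronglyMeasurableAtFilter hg.continuousAt

theorem hasDerivAt_Zq {W w : ℝ → ℝ} (hw : Continuous w) (hWw : W =ᵐ[volume] w) (q x : ℝ) :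
    HasDerivAt (Zq q W) (q * w x) x :=
  ((hasDerivAt_integral_of_ae_eq hw hWw 0 x).const_mul q).const_add 1

theorem continuous_Zq {W w : ℝ → ℝ} (hw : Continuous w) (hWw : W =ᵐ[volume] w) (q : ℝ) :
    Continuous (Zq q W) :=
  continuous_iff_continuousAt.2 fun x => (hasDerivAt_Zq hw hWw q x).continuousAt

theorem hasDerivAt_Zbar {W w : ℝ → ℝ} (hw : Continuous w) (hWw : W =ᵐ[volume] w) (q x : ℝ) :
    HasDerivAt (Zbar q W) (Zq q W x) x :=
  hasDerivAt_integral_of_ae_eq (continuous_Zq hw hWw q) (ae_eq_refl _) 0 x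

theorem hasDerivAt_Jfun {W w : ℝ → ℝ} (hw : Continuous w) (hWw : W =ᵐ[volume] w) (r φ x : ℝ) :
    HasDerivAt (Jfun r φ W) (φ * Jfun r φ W x - r * w x) x := by
  have hint := hasDerivAt_integral_of_ae_eq
    (f := fun z => Real.exp (-φ * z) * W z) (g := fun z => Real.exp (-φ * z) * w z)
    (by fun_prop) (hWw.mono fun z hz => by simp only [hz]) 0 x
  have hexp : HasDerivAt (fun y : ℝ => Real.exp (φ * y)) (Real.exp (φ * x) * (φ * 1)) x :=
    ((hasDerivAt_id x).const_mul φ).exp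
  have hcancel : Real.exp (φ * x) * Real.exp (-φ * x) = 1 := by
    rw [← Real.exp_add]; simp
  refine (hexp.mul ((hint.const_mul r).const_sub 1)).congr_deriv ?_
  unfold Jfun
  linear_combination (-(r * w x)) * hcancel

theorem continuous_Jfun {W w : ℝ → ℝ} (hw : Continuous w) (hWw : W =ᵐ[volume] w) (r φ : ℝ) :
    Continuous (Jfun r φ W) :=
  continuous_iff_continuousAt.2 fun x => (hasDerivAt_Jfun hw hWw r φ x).continuousAt

theorem Jfun_zero (r φ : ℝ) (W : ℝ → ℝ) : Jfun r φ W 0 = 1 := by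
  simp [Jfun]

theorem hasDerivAt_Zqr_s7 {W w : ℝ → ℝ} (hw : Continuous w) (hWw : W =ᵐ[volume] w) (q r φ x : ℝ) :
    HasDerivAt (Zqr q r φ W) (q / (r + q) * φ * Jfun r φ W x) x := by
  refine (((hasDerivAt_Zq hw hWw q x).const_mul (r / (r + q))).add
    ((hasDerivAt_Jfun hw hWw r φ x).const_mul (q / (r + q)))).congr_deriv ?_
  ring

theorem continuous_update_zero {W : ℝ → ℝ} (hneg : ∀ x < (0 : ℝ), W x = 0)
    (hcont : ContinuousOn W (Ioi 0)) (h0 : Tendsto W (𝓝[>] 0) (𝓝 0)) :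
    Continuous (Function.update W 0 0) := by
  refine continuous_iff_continuousAt.2 fun x => ?_
  rcases eq_or_ne x 0 with rfl | hx
  · rw [continuousAt_update_same, ← Iio_union_Ioi, nhdsWithin_union]
    refine Tendsto.sup ?_ h0
    exact tendsto_const_nhds.congr'
      (eventually_nhdsWithin_of_forall fun y hy => (hneg y hy).symm)
  · rw [continuousAt_update_of_ne hx]
    rcases hx.lt_or_gt with hx | hx
    · exact continuousAt_const.congr
        ((eventually_lt_nhds hx).mono fun y hy => (hneg y hy).symm)
    · exact hcont.continuousAt (Ioi_mem_nhds hx)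

theorem hasDerivAt_update_zero {W W' : ℝ → ℝ} (hneg : ∀ x < (0 : ℝ), W x = 0)
    (hderiv : ∀ x : ℝ, 0 < x → HasDerivAt W (W' x) x) {x : ℝ} (hx : x ≠ 0) :
    HasDerivAt (Function.update W 0 0) ((Ioi 0).indicator W' x) x := by
  have heq : Function.update W 0 0 =ᶠ[𝓝 x] W :=
    (eventually_ne_nhds hx).mono fun y hy => Function.update_of_ne hy _ _
  refine HasDerivAt.congr_of_eventuallyEq ?_ heq
  rcases hx.lt_or_gt with hx | hx
  · rw [indicator_of_notMem (by simpa using hx.le)]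
    exact (hasDerivAt_const x (0 : ℝ)).congr_of_eventuallyEq
      ((eventually_lt_nhds hx).mono hneg)
  · rw [indicator_of_mem (by exact hx)]
    exact hderiv x hx

theorem HasDerivAt.comp_reflect {f : ℝ → ℝ} {f' b x : ℝ} (hf : HasDerivAt f f' (b - x)) :
    HasDerivAt (fun y => f (b - y)) (-f') x := by
  simpa using hf.comp_const_sub b x

/-- unbounded-variation case, W(0+) = 0, W ∈ C¹(0,∞) with W′(0+) > 0:
v_b is twice continuously differentiable on ℝ and three times differentiable off b, and the
one-sided limits of v_b‴ at b satisfy (limit from above) − (limit from below)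
= −(rq/(r+q))·W′(0+)·(1 + Cφ); they coincide (v_b is C³ at b) iff C = −1/φ. -/
theorem vb_C3_iff_smooth_fit
    (q r φ : ℝ) (W : ℝ → ℝ)
    (hq : 0 < q) (hr : 0 < r) (hφ : 0 < φ)
    (hWneg : ∀ x < (0:ℝ), W x = 0)
    (hWnn : ∀ x : ℝ, 0 ≤ W x)
    (hWcont : ContinuousOn W (Set.Ioi 0))
    (hWmono : StrictMonoOn W (Set.Ioi 0))
    (W0 : ℝ)
    (hW0 : Filter.Tendsto W (nhdsWithin 0 (Set.Ioi 0)) (nhds W0))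
    (hWint : MeasureTheory.IntegrableOn (fun z => Real.exp (-φ * z) * W z) (Set.Ioi 0))
    (hWlap : r * ∫ z in Set.Ioi (0:ℝ), Real.exp (-φ * z) * W z = 1)
    (hW0zero : W0 = 0)
    (W' : ℝ → ℝ)
    (hWderiv : ∀ x : ℝ, 0 < x → HasDerivAt W (W' x) x)
    (hW'cont : ContinuousOn W' (Set.Ioi 0))
    (W'0 : ℝ)
    (hW'0 : Filter.Tendsto W' (nhdsWithin 0 (Set.Ioi 0)) (nhds W'0))
    (hW'0pos : 0 < W'0)
    (b : ℝ) (hb : 0 < b) (m ρ : ℝ)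
    (H : ℝ → ℝ) (hH : ∀ y : ℝ, H y = r / (r + q) * (Zbar q W y + m / q))
    (C : ℝ) (hC : C = (H b + ρ) / Zqr q r φ W b)
    (vb : ℝ → ℝ) (hvb : ∀ x : ℝ, vb x = C * Zqr q r φ W (b - x) - H (b - x))
    : ∃ D D2 : ℝ → ℝ,
        (∀ x : ℝ, HasDerivAt vb (D x) x) ∧
        (∀ x : ℝ, HasDerivAt D (D2 x) x) ∧
        Continuous D2 ∧
        ∃ D3 : ℝ → ℝ, ∃ Lp Lm : ℝ,
          (∀ x : ℝ, x ≠ b → HasDerivAt D2 (D3 x) x) ∧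
          Filter.Tendsto D3 (nhdsWithin b (Set.Ioi b)) (nhds Lp) ∧
          Filter.Tendsto D3 (nhdsWithin b (Set.Iio b)) (nhds Lm) ∧
          Lp - Lm = -(r * q / (r + q)) * W'0 * (1 + C * φ) ∧
          (Lp = Lm ↔ C = -(1 / φ)) := by
  subst hW0zero
  obtain ⟨w, hwdef⟩ : ∃ w, w = Function.update W 0 0 := ⟨_, rfl⟩
  have hw : Continuous w := hwdef ▸ continuous_update_zero hWneg hWcont hW0
  have hw0 : w 0 = 0 := by simp [hwdef]
  have hWw : W =ᵐ[volume] w := by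
    filter_upwards [Measure.ae_ne volume (0 : ℝ)] with x hx
    rw [hwdef, Function.update_of_ne hx]
  obtain ⟨w', hw'def⟩ : ∃ w', w' = (Ioi (0 : ℝ)).indicator W' := ⟨_, rfl⟩
  have hw' : ∀ x ≠ (0 : ℝ), HasDerivAt w (w' x) x := fun x hx => by
    rw [hwdef, hw'def]; exact hasDerivAt_update_zero hWneg hWderiv hx
  have hw'pos : Tendsto w' (𝓝[>] 0) (𝓝 W'0) := hW'0.congr'
    (eventually_nhdsWithin_of_forall fun y hy => by rw [hw'def, indicator_of_mem hy])
  have hw'neg : Tendsto w' (𝓝[<] 0) (𝓝 0) := tendsto_const_nhds.congr'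
    (eventually_nhdsWithin_of_forall fun y hy => by
      rw [hw'def, indicator_of_notMem (by simpa using (mem_Iio.1 hy).le)])
  have hZ := hasDerivAt_Zqr_s7 hw hWw q r φ
  have hJ := hasDerivAt_Jfun hw hWw r φ
  have hJc := continuous_Jfun hw hWw r φ
  obtain ⟨F3, hF3⟩ : ∃ F3 : ℝ → ℝ, F3 = fun y =>
      C * (q / (r + q) * φ * (φ * (φ * Jfun r φ W y - r * w y) - r * w' y))
        - r / (r + q) * (q * w' y) := ⟨_, rfl⟩
  have hF3lim : ∀ {l : Filter ℝ} {L : ℝ}, l ≤ 𝓝 0 → Tendsto w' l (𝓝 L) →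
      Tendsto F3 l (𝓝 (C * (q / (r + q) * φ * (φ * φ - r * L)) - r / (r + q) * (q * L))) := by
    intro l L hl hL
    have hJ0 : Tendsto (Jfun r φ W) l (𝓝 1) := by
      simpa only [Jfun_zero] using (hJc.tendsto 0).mono_left hl
    have hwl : Tendsto w l (𝓝 0) := by simpa only [hw0] using (hw.tendsto 0).mono_left hl
    have h := ((((((hJ0.const_mul φ).sub (hwl.const_mul r)).const_mul φ).sub
      (hL.const_mul r)).const_mul (q / (r + q) * φ)).const_mul C).sub
        ((hL.const_mul q).const_mul (r / (r + q)))
    rw [hF3]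
    simpa using h
  have hright : Tendsto (fun x => b - x) (𝓝[>] b) (𝓝[<] 0) := by
    refine tendsto_nhdsWithin_iff.2 ⟨?_, eventually_nhdsWithin_of_forall fun x hx => ?_⟩
    · simpa using ((continuous_const.sub continuous_id).tendsto b).mono_left
        (nhdsWithin_le_nhds (s := Ioi b)) (f := fun x => b - x)
    · exact sub_neg.2 (mem_Ioi.1 hx)
  have hleft : Tendsto (fun x => b - x) (𝓝[<] b) (𝓝[>] 0) := by
    refine tendsto_nhdsWithin_iff.2 ⟨?_, eventually_nhdsWithin_of_forall fun x hx => ?_⟩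
    · simpa using ((continuous_const.sub continuous_id).tendsto b).mono_left
        (nhdsWithin_le_nhds (s := Iio b)) (f := fun x => b - x)
    · exact sub_pos.2 (mem_Iio.1 hx)
  have hjump : C * (q / (r + q) * φ * (φ * φ - r * W'0)) - r / (r + q) * (q * W'0)
      - (C * (q / (r + q) * φ * (φ * φ - r * 0)) - r / (r + q) * (q * 0))
      = -(r * q / (r + q)) * W'0 * (1 + C * φ) := by ring
  refine ⟨fun x => -(C * (q / (r + q) * φ * Jfun r φ W (b - x))
      - r / (r + q) * Zq q W (b - x)),
    fun x => C * (q / (r + q) * φ * (φ * Jfun r φ W (b - x) - r * w (b - x)))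
      - r / (r + q) * (q * w (b - x)), fun x => ?_, fun x => ?_, by fun_prop,
    fun x => -F3 (b - x), _, _, fun x hx => ?_,
    ((hF3lim nhdsWithin_le_nhds hw'neg).comp hright).neg,
    ((hF3lim nhdsWithin_le_nhds hw'pos).comp hleft).neg, ?_, ?_⟩
  · obtain rfl : H = fun y => r / (r + q) * (Zbar q W y + m / q) := funext hH
    obtain rfl : vb = fun x => _ := funext hvb
    exact (((hZ _).const_mul C).sub
      (((hasDerivAt_Zbar hw hWw q _).add_const (m / q)).const_mul (r / (r + q)))).comp_reflect
  · exact ((((hJ _).const_mul (q / (r + q) * φ)).const_mul C).sub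
      ((hasDerivAt_Zq hw hWw q _).const_mul (r / (r + q)))).comp_reflect.neg.congr_deriv
        (neg_neg _)
  · have hwx := hw' (b - x) (sub_ne_zero.2 hx.symm)
    rw [hF3]
    exact ((((((hJ _).const_mul φ).sub (hwx.const_mul r)).const_mul
      (q / (r + q) * φ)).const_mul C).sub
        ((hwx.const_mul q).const_mul (r / (r + q)))).comp_reflect
  · linear_combination hjump
  · have hne : -(r * q / (r + q)) * W'0 ≠ 0 := by
      have : 0 < r * q / (r + q) * W'0 := by positivity
      linarith
    rw [neg_inj, eq_comm, ← sub_eq_zero, hjump, mul_eq_zero, or_iff_right hne,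
      eq_neg_iff_add_eq_zero, eq_comm]
    field_simp
    constructor <;> intro h <;> linarith
end

section
/- Let q, r, φ > 0 and m, ρ ∈ ℝ satisfy m ≥ −(q/r)·(q+r)·(ρ + 1/φ). Define v_0(x) := (r/(r+q))·[ x − (m/(r+q) − ρ) + (m/(r+q) + qρ/r)·e^{−φx} ] for x ≥ 0. Then v_0(0) = ρ and v_0′(x) ≤ 1 for every x > 0. -/
open Real Set Filter Topology

/-- if m ≥ −(q/r)(q+r)(ρ + 1/φ) and
v₀(x) = (r/(r+q))·[x − (m/(r+q) − ρ) + (m/(r+q) + qρ/r)·e^{−φx}], then v₀(0) = ρ and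
v₀′(x) ≤ 1 for every x > 0. -/
theorem v0_slope_le_one
    (q r φ m ρ : ℝ)
    (hq : 0 < q) (hr : 0 < r) (hφ : 0 < φ)
    (hm : m ≥ -(q / r) * (q + r) * (ρ + 1 / φ))
    (v₀ : ℝ → ℝ)
    (hv₀ : ∀ x : ℝ, v₀ x =
      r / (r + q) * (x - (m / (r + q) - ρ) + (m / (r + q) + q * ρ / r) * Real.exp (-φ * x)))
    : v₀ 0 = ρ ∧ ∀ x : ℝ, 0 < x → deriv v₀ x ≤ 1 := by
  have hrq : 0 < r + q := by positivity
  constructor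
  · rw [hv₀]
    simp only [mul_zero, Real.exp_zero]
    field_simp
    ring
  · intro x hx
    set C := m / (r + q) + q * ρ / r with hC
    have hderiv : HasDerivAt v₀ (r / (r + q) * (1 + C * (Real.exp (-φ * x) * (-φ)))) x := by
      rw [funext hv₀]
      have hexp : HasDerivAt (fun y : ℝ => Real.exp (-φ * y)) (Real.exp (-φ * x) * (-φ)) x := by
        simpa using ((hasDerivAt_id x).const_mul (-φ)).exp
      exact (((hasDerivAt_id x).sub_const _).add (hexp.const_mul C)).const_mul _
    have hφC : -(q / r) ≤ φ * C := by
      have hdiff : φ * C + q / r =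
          φ / (r + q) * (m - -(q / r) * (q + r) * (ρ + 1 / φ)) := by
        rw [hC]
        field_simp
        ring
      have : 0 ≤ φ / (r + q) * (m - -(q / r) * (q + r) * (ρ + 1 / φ)) :=
        mul_nonneg (by positivity) (sub_nonneg.2 hm)
      linarith
    have hexp_le : Real.exp (-φ * x) ≤ 1 := Real.exp_le_one_iff.2 (by nlinarith)
    have hslope : 1 + C * (Real.exp (-φ * x) * (-φ)) ≤ (r + q) / r := by
      have hqr : 0 < q / r := by positivity
      have hsplit : (r + q) / r = 1 + q / r := by field_simp
      rw [hsplit]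
      nlinarith [mul_le_mul_of_nonneg_right hφC (Real.exp_pos (-φ * x)).le,
        mul_le_mul_of_nonneg_left hexp_le hqr.le]
    rw [hderiv.deriv]
    calc r / (r + q) * (1 + C * (Real.exp (-φ * x) * (-φ)))
        ≤ r / (r + q) * ((r + q) / r) := by gcongr
      _ = 1 := by field_simp
end

section
/- Assume ∫_{[1,∞)} z Π(dz) < ∞, set m := γ − ∫_{[1,∞)} z Π(dz), let q, r > 0, let φ > 0 satisfy ψ(φ) = q + r, and fix b ∈ ℝ. Define g(x) := −(r/(r+q))·(b−x) − (r/(r+q))·(m/q + 1/φ) − (q/((r+q)·φ))·e^{φ(b−x)} for x ∈ ℝ. Then for every x ∈ ℝ the integral in (ℒg)(x) converges absolutely and (ℒ − q)g(x) = (q·r/(r+q))·[ (b−x) + (1 − e^{φ(b−x)})/φ ]. -/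
open MeasureTheory Real Set Filter Topology

/-- The Laplace exponent ψ(θ) = γθ + (σ²/2)θ² + ∫_{(0,∞)} (e^{−θz} − 1 + θz·1_{0<z<1}) ν(dz)
of a spectrally positive Lévy process. -/
noncomputable def levyPsi (γ σ : ℝ) (ν : MeasureTheory.Measure ℝ) (θ : ℝ) : ℝ :=
  γ * θ + σ ^ 2 / 2 * θ ^ 2 +
    ∫ z in Set.Ioi (0:ℝ),
      (Real.exp (-θ * z) - 1 + θ * Set.indicator (Set.Ioo (0:ℝ) 1) id z) ∂ν

/-- The generator (ℒg)(x) = −γg′(x) + (σ²/2)g″(x)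
+ ∫_{(0,∞)} (g(x+z) − g(x) − g′(x)·z·1_{0<z<1}) ν(dz). -/
noncomputable def levyGen (γ σ : ℝ) (ν : MeasureTheory.Measure ℝ) (g : ℝ → ℝ) (x : ℝ) : ℝ :=
  -γ * deriv g x + σ ^ 2 / 2 * deriv (deriv g) x +
    ∫ z in Set.Ioi (0:ℝ),
      (g (x + z) - g x - deriv g x * Set.indicator (Set.Ioo (0:ℝ) 1) id z) ∂ν

/-- Second-order bound for the exponential: `|e^{-u} - 1 + u| ≤ u²` for `u ≥ 0`. -/
theorem abs_exp_neg_sub_one_add_le_sq {u : ℝ} (hu : 0 ≤ u) :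
    |Real.exp (-u) - 1 + u| ≤ u ^ 2 := by
  have hlow := Real.add_one_le_exp (-u)
  have hinv : Real.exp (-u) * Real.exp u = 1 := by rw [← Real.exp_add]; simp
  have hup : Real.exp (-u) * (u + 1) ≤ 1 :=
    (mul_le_mul_of_nonneg_left (Real.add_one_le_exp u) (Real.exp_pos _).le).trans_eq hinv
  rw [abs_le]
  constructor
  · nlinarith [sq_nonneg u]
  · by_contra! h
    nlinarith [pow_nonneg hu 3]

/-- The integrand of the Laplace exponent is integrable against a Lévy measure. -/
theorem integrableOn_levyPsi_integrand {ν : MeasureTheory.Measure ℝ}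
    (hν : IntegrableOn (fun z => min 1 (z ^ 2)) (Ioi 0) ν) {θ : ℝ} (hθ : 0 ≤ θ) :
    IntegrableOn (fun z => Real.exp (-θ * z) - 1 + θ * indicator (Ioo (0:ℝ) 1) id z)
      (Ioi 0) ν := by
  refine (hν.const_mul (1 + θ ^ 2)).mono' ?_ ?_
  · have hind : Measurable (indicator (Ioo (0:ℝ) 1) id) := measurable_id.indicator measurableSet_Ioo
    exact Measurable.aestronglyMeasurable (by fun_prop)
  · filter_upwards [ae_restrict_mem measurableSet_Ioi] with z hz
    have hz0 : 0 < z := hz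
    rw [Real.norm_eq_abs]
    by_cases h1 : z < 1
    · rw [indicator_of_mem (show z ∈ Ioo (0:ℝ) 1 from ⟨hz0, h1⟩), id, neg_mul,
        min_eq_right (by nlinarith)]
      have := abs_exp_neg_sub_one_add_le_sq (mul_nonneg hθ hz0.le)
      nlinarith [sq_nonneg z]
    · rw [indicator_of_notMem (fun h => h1 h.2), min_eq_left (by nlinarith)]
      have hle : Real.exp (-θ * z) ≤ 1 := Real.exp_le_one_iff.2 (by nlinarith)
      have hpos := Real.exp_pos (-θ * z)
      rw [abs_le]
      constructor <;> nlinarith [sq_nonneg θ]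

/-- The generator of an affine function plus an exponential, in terms of the Laplace exponent. -/
theorem levyGen_affine_add_exp {γ σ : ℝ} {ν : MeasureTheory.Measure ℝ}
    (hν : IntegrableOn (fun z => min 1 (z ^ 2)) (Ioi 0) ν)
    (hν1 : IntegrableOn (fun z => z) (Ici 1) ν) {θ : ℝ} (hθ : 0 ≤ θ) (a d c : ℝ) (x : ℝ) {g : ℝ → ℝ}
    (hg : ∀ y, g y = a * y + d + c * Real.exp (-θ * y)) :
    IntegrableOn (fun z => g (x + z) - g x - deriv g x * indicator (Ioo (0:ℝ) 1) id z) (Ioi 0) ν ∧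
      levyGen γ σ ν g x =
        -a * (γ - ∫ z in Ici (1:ℝ), z ∂ν) + c * Real.exp (-θ * x) * levyPsi γ σ ν θ := by
  have hexp (y : ℝ) : HasDerivAt (fun y => Real.exp (-θ * y)) (Real.exp (-θ * y) * -θ) y := by
    simpa using ((hasDerivAt_id y).const_mul (-θ)).exp
  have hd1 : deriv g = fun y => a + c * (Real.exp (-θ * y) * -θ) := by
    funext y
    rw [funext hg]
    have haffine : HasDerivAt (fun y => a * y + d) a y := by
      simpa using ((hasDerivAt_id y).const_mul a).add_const d
    exact (haffine.add ((hexp y).const_mul c)).deriv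
  have hd2 : deriv (deriv g) x = c * (Real.exp (-θ * x) * -θ * -θ) := by
    rw [hd1]
    exact ((((hexp x).mul_const (-θ)).const_mul c).const_add a).deriv
  have hsplit : EqOn (fun z => g (x + z) - g x - deriv g x * indicator (Ioo (0:ℝ) 1) id z)
      (fun z => a * indicator (Ici 1) (fun z => z) z + c * Real.exp (-θ * x) *
        (Real.exp (-θ * z) - 1 + θ * indicator (Ioo (0:ℝ) 1) id z)) (Ioi 0) := by
    intro z hz
    have hz0 : 0 < z := hz
    simp only [hd1, hg, mul_add, Real.exp_add]
    by_cases h1 : z < 1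
    · rw [indicator_of_mem (show z ∈ Ioo (0:ℝ) 1 from ⟨hz0, h1⟩), id,
        indicator_of_notMem (by simpa using h1)]
      ring
    · rw [indicator_of_notMem (fun h => h1 h.2), indicator_of_mem (by simpa using h1)]
      ring
  have hlarge : IntegrableOn (indicator (Ici 1) (fun z : ℝ => z)) (Ioi 0) ν :=
    (hν1.integrable_indicator measurableSet_Ici).integrableOn
  have hpsi := integrableOn_levyPsi_integrand hν hθ
  have hval : ∫ z in Ioi (0:ℝ), indicator (Ici 1) (fun z => z) z ∂ν = ∫ z in Ici (1:ℝ), z ∂ν := by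
    rw [setIntegral_indicator measurableSet_Ici,
      inter_eq_self_of_subset_right (Ici_subset_Ioi.2 one_pos)]
  refine ⟨IntegrableOn.congr_fun ((hlarge.const_mul a).add (hpsi.const_mul _)) hsplit.symm
    measurableSet_Ioi, ?_⟩
  rw [levyGen, setIntegral_congr_fun measurableSet_Ioi hsplit,
    integral_add (hlarge.const_mul a) (hpsi.const_mul _), integral_const_mul, integral_const_mul,
    hval, hd2, hd1, levyPsi]
  ring

/-- with m = γ − ∫_{[1,∞)} z ν(dz), ψ(φ) = q + r, and
g(x) = −(r/(r+q))(b−x) − (r/(r+q))(m/q + 1/φ) − (q/((r+q)φ))e^{φ(b−x)}, the generator integral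
converges absolutely at every x and (ℒ − q)g(x) = (qr/(r+q))·[(b−x) + (1 − e^{φ(b−x)})/φ]. -/
theorem levyGen_value_function_above_barrier
    (γ σ : ℝ) (hσ : 0 ≤ σ) (ν : MeasureTheory.Measure ℝ)
    (hν : MeasureTheory.IntegrableOn (fun z => min 1 (z ^ 2)) (Set.Ioi 0) ν)
    (hν1 : MeasureTheory.IntegrableOn (fun z => z) (Set.Ici 1) ν)
    (m : ℝ) (hm : m = γ - ∫ z in Set.Ici (1:ℝ), z ∂ν)
    (q r φ b : ℝ) (hq : 0 < q) (hr : 0 < r) (hφ : 0 < φ)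
    (hψ : levyPsi γ σ ν φ = q + r)
    (g : ℝ → ℝ)
    (hg : ∀ x : ℝ, g x = -(r / (r + q)) * (b - x) - r / (r + q) * (m / q + 1 / φ) -
      q / ((r + q) * φ) * Real.exp (φ * (b - x)))
    : ∀ x : ℝ,
        MeasureTheory.IntegrableOn
          (fun z => g (x + z) - g x - deriv g x * Set.indicator (Set.Ioo (0:ℝ) 1) id z)
          (Set.Ioi 0) ν ∧
        levyGen γ σ ν g x - q * g x =
          q * r / (r + q) * ((b - x) + (1 - Real.exp (φ * (b - x))) / φ) := by
  intro x
  have hrq : r + q ≠ 0 := by positivity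
  have hform (y : ℝ) : g y = r / (r + q) * y +
      (-(r / (r + q)) * b - r / (r + q) * (m / q + 1 / φ)) +
      -(q / ((r + q) * φ) * Real.exp (φ * b)) * Real.exp (-φ * y) := by
    rw [hg, show φ * (b - y) = φ * b + -φ * y by ring, Real.exp_add]
    ring
  obtain ⟨hint, hgen⟩ := levyGen_affine_add_exp (γ := γ) (σ := σ) hν hν1 hφ.le _ _ _ x hform
  refine ⟨hint, ?_⟩
  rw [hgen, hψ, ← hm, hg, show φ * (b - x) = φ * b + -φ * x by ring, Real.exp_add]
  field_simp
  ring
end
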